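/- arXiv:2109.01029 — 3 statements merged into one kernel-verified Lean document; each statement's English description precedes it below -/
import Mathlib

section
/- Let ξ, η ∈ ℝ³ with ξ ≠ 0, η ≠ 0 and ξ − η ≠ 0. Then Ω_η Φ(ξ,η) = − σ̄(ξ,η) · (ξ_h − η_h)^⊥ / ‖ξ−η‖³, where (ξ_h − η_h)^⊥ = (−(ξ₂−η₂), ξ₁−η₁). -/
/-- Euclidean norm on `ℝ³`. -/
noncomputable def nrm (ξ : Fin 3 → ℝ) : ℝ := Real.sqrt (ξ 0 ^ 2 + ξ 1 ^ 2 + ξ 2 ^ 2)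

/-- The dispersion relation `Λ(ξ) = ξ₃ / ‖ξ‖`. -/
noncomputable def Lam (ξ : Fin 3 → ℝ) : ℝ := ξ 2 / nrm ξ

/-- The phase `Φ(ξ,η) = Λ(ξ) + Λ(ξ−η) + ν Λ(η)`. -/
noncomputable def Phi (ν : ℝ) (ξ η : Fin 3 → ℝ) : ℝ := Lam ξ + Lam (ξ - η) + ν * Lam η

/-- Scaling vector field `S_η f = η · ∇_η f`. -/
noncomputable def SV (f : (Fin 3 → ℝ) → ℝ) : (Fin 3 → ℝ) → ℝ := fun η => fderiv ℝ f η η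

/-- Rotation vector field `Ω_η f = −η₂ ∂_{η₁} f + η₁ ∂_{η₂} f`. -/
noncomputable def OV (f : (Fin 3 → ℝ) → ℝ) : (Fin 3 → ℝ) → ℝ :=
  fun η => fderiv ℝ f η ![-(η 1), η 0, 0]

theorem sum_sq_pos {x : Fin 3 → ℝ} (hx : x ≠ 0) : 0 < x 0 ^ 2 + x 1 ^ 2 + x 2 ^ 2 := by
  obtain ⟨i, hi⟩ := Function.ne_iff.mp hx
  have hi' : 0 < x i ^ 2 := sq_pos_of_ne_zero hi
  fin_cases i <;> simp at hi' <;> positivity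

/-- The Euclidean norm on `ℝ³` is differentiable away from the origin. -/
theorem hasFDerivAt_nrm {x : Fin 3 → ℝ} (hx : x ≠ 0) :
    HasFDerivAt nrm ((nrm x)⁻¹ • (x 0 • ContinuousLinearMap.proj (R := ℝ) (φ := fun _ => ℝ) 0 +
      x 1 • ContinuousLinearMap.proj 1 + x 2 • ContinuousLinearMap.proj 2)) x := by
  have hp (i : Fin 3) : HasFDerivAt (fun y : Fin 3 → ℝ => y i)
      (ContinuousLinearMap.proj (R := ℝ) (φ := fun _ => ℝ) i) x := hasFDerivAt_apply i x
  have h := ((((hp 0).pow 2).add ((hp 1).pow 2)).add ((hp 2).pow 2)).sqrt (sum_sq_pos hx).ne'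
  refine h.congr_fderiv ?_
  ext v
  simp [nrm]
  ring

/-- The derivative of `Λ` away from the origin, applied to a vector. -/
theorem hasFDerivAt_Lam {x : Fin 3 → ℝ} (hx : x ≠ 0) :
    ∃ L : (Fin 3 → ℝ) →L[ℝ] ℝ, HasFDerivAt Lam L x ∧
      ∀ v, L v = v 2 / nrm x - x 2 * (x 0 * v 0 + x 1 * v 1 + x 2 * v 2) / nrm x ^ 3 := by
  have hn : nrm x ≠ 0 := (Real.sqrt_pos.mpr (sum_sq_pos hx)).ne'
  have hp : HasFDerivAt (fun y : Fin 3 → ℝ => y 2)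
      (ContinuousLinearMap.proj (R := ℝ) (φ := fun _ => ℝ) 2) x := hasFDerivAt_apply 2 x
  have hinv := (hasDerivAt_inv hn).comp_hasFDerivAt x (hasFDerivAt_nrm hx)
  refine ⟨_, hp.mul hinv, fun v => ?_⟩
  simp
  field_simp
  ring

/-- `Ω_η Φ(ξ,η) = −σ̄(ξ,η) · (ξ_h − η_h)^⊥ / ‖ξ−η‖³`, with
`σ̄(ξ,η) = ξ₃ η_h − η₃ ξ_h` and `(ξ_h − η_h)^⊥ = (−(ξ₂−η₂), ξ₁−η₁)`. -/
theorem stmt3 (ν : ℝ) (hν : ν = 1 ∨ ν = -1) (ξ η : Fin 3 → ℝ)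
    (hξ : ξ ≠ 0) (hη : η ≠ 0) (hξη : ξ - η ≠ 0) :
    OV (Phi ν ξ) η =
      -(((ξ 2 * η 0 - η 2 * ξ 0) * (-(ξ 1 - η 1)) + (ξ 2 * η 1 - η 2 * ξ 1) * (ξ 0 - η 0)) /
        nrm (ξ - η) ^ 3) := by
  obtain ⟨L, hL, hLv⟩ := hasFDerivAt_Lam hξη
  obtain ⟨M, hM, hMv⟩ := hasFDerivAt_Lam hη
  have hsub := hL.comp η ((hasFDerivAt_id η).const_sub ξ)
  have hPhi : HasFDerivAt (Phi ν ξ) _ η := (hsub.const_add (Lam ξ)).add (hM.const_mul ν)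
  rw [OV, hPhi.fderiv]
  simp [hLv, hMv]
  ring
end

section
/- There exists an absolute constant c ∈ (0,1) with the following property. Let μ, ν ∈ {−1,+1}, and let ξ, η ∈ ℝ³ with ξ, η, ξ−η all nonzero. Set Φ(ξ,η) = Λ(ξ) + μΛ(ξ−η) + νΛ(η), Q = max(|Λ(ξ)|, |Λ(ξ−η)|, |Λ(η)|), P = max(‖ξ_h‖/‖ξ‖, ‖(ξ−η)_h‖/‖ξ−η‖, ‖η_h‖/‖η‖), and let K_max and K_min be respectively the largest and the smallest of ‖ξ‖, ‖ξ−η‖, ‖η‖. If |Φ(ξ,η)| ≤ 2^{−12} Q, then P ≥ c and ‖σ̄(ξ,η)‖ ≥ c · Q · K_max · K_min. -/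
/-- Norm of the horizontal part `ξ_h = (ξ₁,ξ₂)`. -/
noncomputable def nh (ξ : Fin 3 → ℝ) : ℝ := Real.sqrt (ξ 0 ^ 2 + ξ 1 ^ 2)

theorem nrm_eq_norm (ξ : Fin 3 → ℝ) : nrm ξ = ‖WithLp.toLp 2 ξ‖ := by
  simp [nrm, EuclideanSpace.norm_eq, Fin.sum_univ_three]

theorem nrm_sq (ξ : Fin 3 → ℝ) : nrm ξ ^ 2 = ξ 0 ^ 2 + ξ 1 ^ 2 + ξ 2 ^ 2 :=
  Real.sq_sqrt (by positivity)

theorem nrm_pos {ξ : Fin 3 → ℝ} (hξ : ξ ≠ 0) : 0 < nrm ξ := by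
  rw [nrm_eq_norm, norm_pos_iff]
  simpa using hξ

theorem abs_Lam (ξ : Fin 3 → ℝ) : |Lam ξ| = |ξ 2| / nrm ξ := by
  rw [Lam, abs_div, abs_of_nonneg (show 0 ≤ nrm ξ from Real.sqrt_nonneg _)]

theorem Lam_sq_add_sq {ξ : Fin 3 → ℝ} (hξ : ξ ≠ 0) :
    |Lam ξ| ^ 2 + (nh ξ / nrm ξ) ^ 2 = 1 := by
  have h := nrm_pos hξ
  have hh : nh ξ ^ 2 = ξ 0 ^ 2 + ξ 1 ^ 2 := Real.sq_sqrt (by positivity)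
  rw [sq_abs, Lam, div_pow, div_pow, ← add_div, hh, nrm_sq,
    div_eq_one_iff_eq (by rw [← nrm_sq]; positivity)]
  ring

/-- The horizontal part of the cross product controls the difference of the `|Λ|`. -/
theorem abs_Lam_sub_mul_le {a b : Fin 3 → ℝ} (ha : a ≠ 0) (hb : b ≠ 0) :
    |(|Lam a| - |Lam b|)| * (nrm a * nrm b) ≤
      Real.sqrt ((a 2 * b 0 - b 2 * a 0) ^ 2 + (a 2 * b 1 - b 2 * a 1) ^ 2) := by
  have hA := nrm_pos ha
  have hB := nrm_pos hb
  have hA2 := nrm_sq a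
  have hB2 := nrm_sq b
  have hAB : 0 < nrm a * nrm b := mul_pos hA hB
  apply Real.le_sqrt_of_sq_le
  have hcs : ∀ t : ℝ, t ^ 2 = (b 2) ^ 2 →
      a 0 * b 0 + a 1 * b 1 + a 2 * t ≤ nrm a * nrm b := by
    intro t ht
    apply le_of_sq_le_sq _ hAB.le
    rw [mul_pow, hA2, hB2, ← ht]
    nlinarith [sq_nonneg (a 0 * b 1 - a 1 * b 0), sq_nonneg (a 0 * t - a 2 * b 0),
      sq_nonneg (a 1 * t - a 2 * b 1)]
  have hcs' : ∀ t : ℝ, t ^ 2 = (b 2) ^ 2 →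
      -(a 0 * b 0 + a 1 * b 1) + a 2 * t ≤ nrm a * nrm b := by
    intro t ht
    apply le_of_sq_le_sq _ hAB.le
    rw [mul_pow, hA2, hB2, ← ht]
    nlinarith [sq_nonneg (a 0 * b 1 - a 1 * b 0), sq_nonneg (a 0 * t + a 2 * b 0),
      sq_nonneg (a 1 * t + a 2 * b 1)]
  have key : a 2 * b 2 * (a 0 * b 0 + a 1 * b 1) + (a 2 * b 2) ^ 2 ≤
      |a 2| * |b 2| * (nrm a * nrm b) := by
    rw [← abs_mul]
    rcases abs_cases (a 2 * b 2) with ⟨h, h0⟩ | ⟨h, h0⟩ <;> rw [h]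
    · nlinarith [mul_le_mul_of_nonneg_left (hcs (b 2) rfl) h0]
    · nlinarith [mul_le_mul_of_nonneg_left (hcs' (-b 2) (by ring)) (neg_nonneg.2 h0.le)]
  have hL : (|Lam a| - |Lam b|) * (nrm a * nrm b) = |a 2| * nrm b - |b 2| * nrm a := by
    rw [abs_Lam, abs_Lam]
    field_simp
  rw [mul_pow, sq_abs, ← mul_pow, hL, sub_sq, mul_pow, mul_pow, sq_abs, sq_abs, hA2, hB2]
  linarith

theorem two_mul_sub_le_abs_add {u v w m M : ℝ} (hu : m ≤ |u|) (hv : m ≤ |v|) (hw : m ≤ |w|)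
    (hu' : |u| ≤ M) (hv' : |v| ≤ M) (hw' : |w| ≤ M) : 2 * m - M ≤ |u + v + w| := by
  rcases abs_cases u with ⟨h1, _⟩ | ⟨h1, _⟩ <;> rcases abs_cases v with ⟨h2, _⟩ | ⟨h2, _⟩ <;>
    rcases abs_cases w with ⟨h3, _⟩ | ⟨h3, _⟩ <;>
    linarith [le_abs_self (u + v + w), neg_abs_le (u + v + w)]

/-- A bound on a difference weighted by `A * C`, with `A` comparable to `K`, bounds the difference
itself. -/
theorem abs_sub_lt_of_mul_le {p q A C K S Q : ℝ} (hC : 0 < C) (hK : 0 < K) (hAK : K ≤ 2 * A)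
    (h : |p - q| * (A * C) ≤ S) (hS : S < 1 / 100 * (Q * K * C)) : |p - q| < Q / 50 := by
  have h1 : |p - q| * A < 1 / 100 * (Q * K) := by
    by_contra! hc
    nlinarith [mul_le_mul_of_nonneg_right hc hC.le]
  by_contra! hc
  nlinarith [mul_le_mul_of_nonneg_right hc hK.le,
    mul_le_mul_of_nonneg_left hAK (abs_nonneg (p - q))]

/-- Side lengths `A, B, C` of a triangle, weighted differences of `p, q, r` small: then all of
`p, q, r` are close to their maximum. -/
theorem max_mul_le_min_of_triangle {p q r A B C S : ℝ} (hA : 0 < A) (hB : 0 < B) (hC : 0 < C)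
    (hABC : A ≤ B + C) (hBAC : B ≤ A + C) (hCAB : C ≤ A + B)
    (hpq : |p - q| * (A * B) ≤ S) (hpr : |p - r| * (A * C) ≤ S) (hqr : |q - r| * (B * C) ≤ S)
    (hS : S < 1 / 100 * (max p (max q r) * max A (max B C) * min A (min B C))) :
    24 / 25 * max p (max q r) ≤ min p (min q r) := by
  set Q := max p (max q r) with hQ
  have hQc : Q = p ∨ Q = q ∨ Q = r := by grind
  set K := max A (max B C) with hKdef
  have hK : 0 < K := lt_of_lt_of_le hA (le_max_left _ _)
  have hmin : (min A (min B C) = A ∧ A ≤ B ∧ A ≤ C) ∨ (min A (min B C) = B ∧ B ≤ A ∧ B ≤ C) ∨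
    (min A (min B C) = C ∧ C ≤ A ∧ C ≤ B) := by grind
  have hpQ : p ≤ Q := le_max_left _ _
  have hqQ : q ≤ Q := by grind
  have hrQ : r ≤ Q := by grind
  rw [mul_comm A B] at hpq
  have hKA : A ≤ K := le_max_left _ _
  rcases hmin with ⟨hm, h1, h2⟩ | ⟨hm, h1, h2⟩ | ⟨hm, h1, h2⟩ <;> rw [hm] at hS
  · have e1 := abs_sub_lt_of_mul_le (A := B) hA hK (by grind) hpq hS
    have e2 := abs_sub_lt_of_mul_le (A := C) hA hK (by grind) (by rwa [mul_comm C A]) hS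
    rw [abs_lt] at e1 e2
    refine le_min ?_ (le_min ?_ ?_) <;> rcases hQc with h | h | h <;> linarith
  · have e1 := abs_sub_lt_of_mul_le (A := A) hB hK (by grind) (by rwa [mul_comm A B]) hS
    have e2 := abs_sub_lt_of_mul_le (A := C) hB hK (by grind) (by rwa [mul_comm C B]) hS
    rw [abs_lt] at e1 e2
    refine le_min ?_ (le_min ?_ ?_) <;> rcases hQc with h | h | h <;> linarith
  · have e1 := abs_sub_lt_of_mul_le (A := A) hC hK (by grind) hpr hS
    have e2 := abs_sub_lt_of_mul_le (A := B) hC hK (by grind) hqr hS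
    rw [abs_lt] at e1 e2
    refine le_min ?_ (le_min ?_ ?_) <;> rcases hQc with h | h | h <;> linarith

/-- The dichotomy: if `|Φ| ≤ 2^{−12}·Q` then the horizontal components are of
order one and `‖σ̄(ξ,η)‖ ≥ c·Q·K_max·K_min`. -/
theorem stmt8 : ∃ c : ℝ, 0 < c ∧ c < 1 ∧
    ∀ μ ν : ℝ, (μ = 1 ∨ μ = -1) → (ν = 1 ∨ ν = -1) →
    ∀ ξ η : Fin 3 → ℝ, ξ ≠ 0 → η ≠ 0 → ξ - η ≠ 0 →
    |Lam ξ + μ * Lam (ξ - η) + ν * Lam η| ≤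
        (2 : ℝ) ^ (-12 : ℤ) * max |Lam ξ| (max |Lam (ξ - η)| |Lam η|) →
    (c ≤ max (nh ξ / nrm ξ) (max (nh (ξ - η) / nrm (ξ - η)) (nh η / nrm η)) ∧
     c * (max |Lam ξ| (max |Lam (ξ - η)| |Lam η|) *
          (max (nrm ξ) (max (nrm (ξ - η)) (nrm η))) *
          (min (nrm ξ) (min (nrm (ξ - η)) (nrm η)))) ≤
        Real.sqrt ((ξ 2 * η 0 - η 2 * ξ 0) ^ 2 + (ξ 2 * η 1 - η 2 * ξ 1) ^ 2)) := by
  refine ⟨1 / 100, by norm_num, by norm_num, ?_⟩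
  intro μ ν hμ hν ξ η hξ hη hd hΦ
  have hμ1 : |μ * Lam (ξ - η)| = |Lam (ξ - η)| := by rcases hμ with rfl | rfl <;> simp
  have hν1 : |ν * Lam η| = |Lam η| := by rcases hν with rfl | rfl <;> simp
  have hlow : ∀ m M : ℝ, m ≤ min |Lam ξ| (min |Lam (ξ - η)| |Lam η|) →
      max |Lam ξ| (max |Lam (ξ - η)| |Lam η|) ≤ M →
      2 * m - M ≤ |Lam ξ + μ * Lam (ξ - η) + ν * Lam η| := by
    intro m M hm hM
    simp only [le_min_iff, max_le_iff] at hm hM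
    apply two_mul_sub_le_abs_add <;> simp only [hμ1, hν1, hm, hM]
  have eξ := Lam_sq_add_sq hξ
  have eη := Lam_sq_add_sq hη
  have ed := Lam_sq_add_sq hd
  have le_one : ∀ ζ : Fin 3 → ℝ, |Lam ζ| ^ 2 + (nh ζ / nrm ζ) ^ 2 = 1 → |Lam ζ| ≤ 1 :=
    fun ζ h ↦ by nlinarith [sq_nonneg (nh ζ / nrm ζ)]
  have hQ1 : max |Lam ξ| (max |Lam (ξ - η)| |Lam η|) ≤ 1 :=
    max_le (le_one _ eξ) (max_le (le_one _ ed) (le_one _ eη))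
  norm_num at hΦ
  constructor
  · by_contra! hP
    simp only [max_lt_iff] at hP
    have ge : ∀ ζ : Fin 3 → ℝ, |Lam ζ| ^ 2 + (nh ζ / nrm ζ) ^ 2 = 1 →
        nh ζ / nrm ζ < 1 / 100 → 9 / 10 ≤ |Lam ζ| := by
      intro ζ h hlt
      have h0 : 0 ≤ nh ζ / nrm ζ := div_nonneg (Real.sqrt_nonneg _) (Real.sqrt_nonneg _)
      nlinarith [abs_nonneg (Lam ζ)]
    have := hlow (9 / 10) 1
      (le_min (ge _ eξ hP.1) (le_min (ge _ ed hP.2.1) (ge _ eη hP.2.2))) hQ1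
    linarith
  · by_contra! hS
    have t1 : nrm ξ ≤ nrm (ξ - η) + nrm η := by
      simpa [nrm_eq_norm] using norm_le_norm_sub_add (WithLp.toLp 2 ξ) (WithLp.toLp 2 η)
    have t2 : nrm (ξ - η) ≤ nrm ξ + nrm η := by
      simpa [nrm_eq_norm] using norm_sub_le (WithLp.toLp 2 ξ) (WithLp.toLp 2 η)
    have t3 : nrm η ≤ nrm ξ + nrm (ξ - η) := by
      simpa [nrm_eq_norm] using norm_le_norm_add_norm_sub (WithLp.toLp 2 ξ) (WithLp.toLp 2 η)
    have p1 := abs_Lam_sub_mul_le hξ hd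
    have p2 := abs_Lam_sub_mul_le hξ hη
    have p3 := abs_Lam_sub_mul_le hd hη
    simp only [Pi.sub_apply] at p1 p3
    have hm := max_mul_le_min_of_triangle (nrm_pos hξ) (nrm_pos hd) (nrm_pos hη) t1 t2 t3
      (p1.trans_eq (by ring_nf)) p2 (p3.trans_eq (by ring_nf)) hS
    have hl := hlow _ _ hm le_rfl
    have hpos : max |Lam ξ| (max |Lam (ξ - η)| |Lam η|) ≤ 0 := by linarith
    have hK : 0 ≤ max (nrm ξ) (max (nrm (ξ - η)) (nrm η)) :=
      (nrm_pos hξ).le.trans (le_max_left _ _)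
    have hk : 0 ≤ min (nrm ξ) (min (nrm (ξ - η)) (nrm η)) :=
      le_min (nrm_pos hξ).le (le_min (nrm_pos hd).le (nrm_pos hη).le)
    have := mul_nonpos_of_nonpos_of_nonneg (mul_nonpos_of_nonpos_of_nonneg hpos hK) hk
    have := Real.sqrt_nonneg ((ξ 2 * η 0 - η 2 * ξ 0) ^ 2 + (ξ 2 * η 1 - η 2 * ξ 1) ^ 2)
    linarith
end

section
/- Let r ≥ 1 and n ≥ 0 be integers and let f ∈ C_c^∞(ℝ³;ℝ). Then ‖S^{≤n+1}f‖²_{L^{2r}} ≤ 2(r+1) · ‖S^{≤n}f‖_{L^{2r}} · ‖S^{≤n+2}f‖_{L^{2r}}. -/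
open MeasureTheory

/-- The scaling vector field `(Sf)(x) = x·∇f(x)`. -/
noncomputable def Sop (f : (Fin 3 → ℝ) → ℝ) : (Fin 3 → ℝ) → ℝ := fun x => fderiv ℝ f x x

/-- `‖S^{≤n}f‖_{L^{2r}} = max_{0≤α≤n} ‖S^α f‖_{L^{2r}}`. -/
noncomputable def SleNorm (r n : ℕ) (f : (Fin 3 → ℝ) → ℝ) : ℝ :=
  ⨆ α : Fin (n + 1), (eLpNorm (Sop^[(α : ℕ)] f) (2 * r) volume).toReal

lemma hasCompactSupport_Sop {f : (Fin 3 → ℝ) → ℝ} (hf : HasCompactSupport f) :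
    HasCompactSupport (Sop f) := by
  refine (hf.fderiv (𝕜 := ℝ)).mono fun x hx h => hx ?_
  simp [Sop, h]

lemma contDiff_Sop {f : (Fin 3 → ℝ) → ℝ} (hf : ContDiff ℝ (⊤ : ℕ∞) f) :
    ContDiff ℝ (⊤ : ℕ∞) (Sop f) :=
  (hf.fderiv_right (m := (⊤ : ℕ∞)) (by simp)).clm_apply contDiff_id

lemma contDiff_and_hasCompactSupport_iterate_Sop {f : (Fin 3 → ℝ) → ℝ}
    (hf : ContDiff ℝ (⊤ : ℕ∞) f) (hsupp : HasCompactSupport f) (k : ℕ) :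
    ContDiff ℝ (⊤ : ℕ∞) (Sop^[k] f) ∧ HasCompactSupport (Sop^[k] f) := by
  induction k with
  | zero => exact ⟨hf, hsupp⟩
  | succ k ih =>
    rw [Function.iterate_succ_apply']
    exact ⟨contDiff_Sop ih.1, hasCompactSupport_Sop ih.2⟩

/-- The formal adjoint of the scaling vector field on `ℝ³` is `-(S + 3)`. -/
lemma integral_Sop {h : (Fin 3 → ℝ) → ℝ} (hh : ContDiff ℝ 1 h) (hc : HasCompactSupport h) :
    ∫ x, Sop h x = -3 * ∫ x, h x := by
  have hd : Continuous (fderiv ℝ h) := hh.continuous_fderiv one_ne_zero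
  have hint (i : Fin 3) :
      Integrable fun x : Fin 3 → ℝ => x i * fderiv ℝ h x (Pi.single i 1) :=
    Continuous.integrable_of_hasCompactSupport (by fun_prop)
      ((hc.fderiv_apply (𝕜 := ℝ) (Pi.single i 1)).mul_left (f := fun x : Fin 3 → ℝ => x i))
  have hcoord (i : Fin 3) (x : Fin 3 → ℝ) :
      fderiv ℝ (fun y : Fin 3 → ℝ => y i) x (Pi.single i 1) = 1 := by
    have := (ContinuousLinearMap.proj (R := ℝ) (φ := fun _ : Fin 3 => ℝ) i).hasFDerivAt (x := x)
    rw [show (fun y : Fin 3 → ℝ => y i) =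
      ContinuousLinearMap.proj (R := ℝ) (φ := fun _ : Fin 3 => ℝ) i from rfl, this.fderiv]
    simp
  have hparts (i : Fin 3) :
      ∫ x : Fin 3 → ℝ, x i * fderiv ℝ h x (Pi.single i 1) = -∫ x, h x := by
    rw [integral_mul_fderiv_eq_neg_fderiv_mul_of_integrable (f := fun x : Fin 3 → ℝ => x i)
      _ (hint i)]
    · simp [hcoord]
    · exact Continuous.integrable_of_hasCompactSupport
        ((continuous_apply i).mul hh.continuous) hc.mul_left
    · intro x _
      fun_prop
    · intro x _
      exact hh.differentiable one_ne_zero x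
    · simpa [hcoord] using hh.continuous.integrable_of_hasCompactSupport hc
  have hS (x : Fin 3 → ℝ) : Sop h x = ∑ i, x i * fderiv ℝ h x (Pi.single i 1) := by
    have hx : x = ∑ i, x i • Pi.single i (1 : ℝ) := by
      simp [← Pi.single_smul, Finset.univ_sum_single]
    calc fderiv ℝ h x x = fderiv ℝ h x (∑ i, x i • Pi.single i (1 : ℝ)) := by rw [← hx]
      _ = _ := by simp only [map_sum, map_smul, smul_eq_mul]
  simp_rw [hS]
  rw [integral_finsetSum _ fun i _ => hint i]
  simp [hparts]

open scoped ENNReal in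
/-- Hölder's inequality for a product of `k + 2` factors, `k` of which coincide. -/
lemma lintegral_mul_pow_mul_le_eLpNorm {α : Type*} [MeasurableSpace α] {μ : Measure α}
    {g u v : α → ℝ} (hg : AEMeasurable g μ) (hu : AEMeasurable u μ) (hv : AEMeasurable v μ)
    (k : ℕ) :
    ∫⁻ x, ‖g x‖ₑ * ‖u x‖ₑ ^ k * ‖v x‖ₑ ∂μ ≤
      eLpNorm g (k + 2 : ℕ) μ * eLpNorm u (k + 2 : ℕ) μ ^ k * eLpNorm v (k + 2 : ℕ) μ := by
  have hp : ((k + 2 : ℕ) : ℝ) ≠ 0 := by positivity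
  have hnorm (w : α → ℝ) : eLpNorm w (k + 2 : ℕ) μ =
      (∫⁻ x, ‖w x‖ₑ ^ ((k + 2 : ℕ) : ℝ) ∂μ) ^ (1 / ((k + 2 : ℕ) : ℝ)) := by
    rw [eLpNorm_eq_lintegral_rpow_enorm_toReal (by simp) (ENNReal.natCast_ne_top _),
      ENNReal.toReal_natCast]
  have hroot (a : ℝ≥0∞) : (a ^ ((k + 2 : ℕ) : ℝ)) ^ (1 / ((k + 2 : ℕ) : ℝ)) = a := by
    rw [← ENNReal.rpow_mul, mul_one_div_cancel hp, ENNReal.rpow_one]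
  have hpow (a : ℝ≥0∞) :
      a ^ ((k : ℝ) / ((k + 2 : ℕ) : ℝ)) = (a ^ (1 / ((k + 2 : ℕ) : ℝ))) ^ k := by
    rw [← ENNReal.rpow_natCast, ← ENNReal.rpow_mul]
    congr 1
    ring
  have H := ENNReal.lintegral_prod_norm_pow_le (μ := μ) Finset.univ
    (f := ![fun x => ‖g x‖ₑ ^ ((k + 2 : ℕ) : ℝ), fun x => ‖u x‖ₑ ^ ((k + 2 : ℕ) : ℝ),
      fun x => ‖v x‖ₑ ^ ((k + 2 : ℕ) : ℝ)])
    (p := ![1 / ((k + 2 : ℕ) : ℝ), k / ((k + 2 : ℕ) : ℝ), 1 / ((k + 2 : ℕ) : ℝ)])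
    (by
      intro i _
      fin_cases i
      exacts [hg.enorm.pow_const _, hu.enorm.pow_const _, hv.enorm.pow_const _])
    (by
      simp only [Fin.sum_univ_three, Matrix.cons_val]
      field_simp
      push_cast
      ring)
    (by
      intro i _
      fin_cases i <;> simp <;> positivity)
  simp only [Fin.prod_univ_three, Matrix.cons_val, hpow, hroot] at H
  simpa only [hnorm] using H

lemma abs_integral_mul_pow_mul_le {α : Type*} [MeasurableSpace α] {μ : Measure α}
    {g u v : α → ℝ} {k : ℕ} (hg : MemLp g (k + 2 : ℕ) μ) (hu : MemLp u (k + 2 : ℕ) μ)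
    (hv : MemLp v (k + 2 : ℕ) μ) :
    |∫ x, g x * u x ^ k * v x ∂μ| ≤ (eLpNorm g (k + 2 : ℕ) μ).toReal *
      (eLpNorm u (k + 2 : ℕ) μ).toReal ^ k * (eLpNorm v (k + 2 : ℕ) μ).toReal := by
  have H := (enorm_integral_le_lintegral_enorm fun x => g x * u x ^ k * v x).trans
    ((lintegral_congr fun x => by simp only [enorm_mul, enorm_pow]).trans_le
      (lintegral_mul_pow_mul_le_eLpNorm hg.aestronglyMeasurable.aemeasurable
        hu.aestronglyMeasurable.aemeasurable hv.aestronglyMeasurable.aemeasurable k))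
  have H' := ENNReal.toReal_mono (ENNReal.mul_ne_top (ENNReal.mul_ne_top hg.eLpNorm_ne_top
    (ENNReal.pow_ne_top hu.eLpNorm_ne_top)) hv.eLpNorm_ne_top) H
  simpa using H'

lemma eLpNorm_toReal_pow_eq_integral {α : Type*} [MeasurableSpace α] {μ : Measure α}
    {u : α → ℝ} {p : ℕ} (hp : Even p) (hp0 : p ≠ 0) (hu : MemLp u p μ) :
    (eLpNorm u p μ).toReal ^ p = ∫ x, u x ^ p ∂μ := by
  rw [hu.eLpNorm_eq_integral_rpow_norm (by simpa) (ENNReal.natCast_ne_top _),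
    ENNReal.toReal_ofReal (by positivity)]
  simp only [ENNReal.toReal_natCast, Real.rpow_natCast, Real.norm_eq_abs, hp.pow_abs]
  rw [← Real.rpow_natCast, ← Real.rpow_mul (integral_nonneg fun x => hp.pow_nonneg _),
    inv_mul_cancel₀ (by exact_mod_cast hp0), Real.rpow_one]

lemma Sop_mul_pow {g u : (Fin 3 → ℝ) → ℝ} {x : Fin 3 → ℝ} (hg : DifferentiableAt ℝ g x)
    (hu : DifferentiableAt ℝ u x) (k : ℕ) :
    Sop (fun y => g y * u y ^ (k + 1)) x =
      Sop g x * u x ^ (k + 1) + (k + 1) * (g x * u x ^ k * Sop u x) := by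
  have h := (hg.hasFDerivAt.mul (hu.hasFDerivAt.pow (k + 1))).fderiv
  change fderiv ℝ (g * fun y => u y ^ (k + 1)) x x = _
  rw [h]
  simp [Sop]
  ring

/-- The log-convexity inequality for three consecutive powers of the scaling vector field. -/
lemma sq_eLpNorm_Sop_le {g : (Fin 3 → ℝ) → ℝ} (hg : ContDiff ℝ (⊤ : ℕ∞) g)
    (hc : HasCompactSupport g) {k : ℕ} (hk : Even k) :
    (eLpNorm (Sop g) (k + 2 : ℕ) volume).toReal ^ 2 ≤
      3 * ((eLpNorm g (k + 2 : ℕ) volume).toReal * (eLpNorm (Sop g) (k + 2 : ℕ) volume).toReal) +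
      (k + 1) * ((eLpNorm g (k + 2 : ℕ) volume).toReal *
        (eLpNorm (Sop (Sop g)) (k + 2 : ℕ) volume).toReal) := by
  have hu := contDiff_Sop hg
  have huc := hasCompactSupport_Sop hc
  have hv := contDiff_Sop hu
  have hvc := hasCompactSupport_Sop huc
  have hgL := hg.continuous.memLp_of_hasCompactSupport (p := (k + 2 : ℕ)) (μ := volume) hc
  have huL := hu.continuous.memLp_of_hasCompactSupport (p := (k + 2 : ℕ)) (μ := volume) huc
  have hvL := hv.continuous.memLp_of_hasCompactSupport (p := (k + 2 : ℕ)) (μ := volume) hvc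
  set u := Sop g with hu_def
  set v := Sop u with hv_def
  have hkey := integral_Sop (h := fun x => g x * u x ^ (k + 1))
    ((hg.mul (hu.pow (k + 1))).of_le (by exact_mod_cast le_top)) hc.mul_right
  have hgc := hg.continuous
  have huc' := hu.continuous
  have hvc' := hv.continuous
  have hi₁ : Integrable fun x => u x ^ (k + 2) := by
    refine Continuous.integrable_of_hasCompactSupport (by fun_prop) ?_
    simp_rw [pow_succ']
    exact huc.mul_right
  have hi₂ : Integrable fun x => g x * u x ^ k * v x :=
    Continuous.integrable_of_hasCompactSupport (by fun_prop) hvc.mul_left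
  have hS : ∫ x, Sop (fun y => g y * u y ^ (k + 1)) x =
      (∫ x, u x ^ (k + 2)) + (k + 1) * ∫ x, g x * u x ^ k * v x := by
    rw [← integral_const_mul, ← integral_add hi₁ (hi₂.const_mul _)]
    refine integral_congr_ae (Filter.Eventually.of_forall fun x => ?_)
    beta_reduce
    rw [Sop_mul_pow (hg.differentiable (by simp) x) (hu.differentiable (by simp) x)]
    rw [← hu_def, ← hv_def]
    ring
  have h₁ := abs_le.1 (abs_integral_mul_pow_mul_le hgL huL huL)
  have h₂ := abs_le.1 (abs_integral_mul_pow_mul_le hgL huL hvL)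
  have hpow := eLpNorm_toReal_pow_eq_integral (hk.add even_two) (by positivity) huL
  simp_rw [pow_succ (u _) k, ← mul_assoc] at hkey hS
  rw [hS, ← hpow] at hkey
  set A := (eLpNorm g (k + 2 : ℕ) volume).toReal
  set B := (eLpNorm u (k + 2 : ℕ) volume).toReal
  set C := (eLpNorm v (k + 2 : ℕ) volume).toReal
  have hA : 0 ≤ A := ENNReal.toReal_nonneg
  have hB : 0 ≤ B := ENNReal.toReal_nonneg
  have hC : 0 ≤ C := ENNReal.toReal_nonneg
  have hbound : B ^ k * B ^ 2 ≤ B ^ k * (3 * (A * B) + (k + 1) * (A * C)) := by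
    have := mul_le_mul_of_nonneg_left h₂.1 (by positivity : (0 : ℝ) ≤ k + 1)
    rw [pow_add] at hkey
    linarith [h₁.1]
  rcases hB.eq_or_lt with hB0 | hB0
  · rw [← hB0]
    have : 0 ≤ A * C := by positivity
    nlinarith [mul_nonneg (k.cast_nonneg (α := ℝ)) this]
  · exact le_of_mul_le_mul_left hbound (by positivity)

lemma eLpNorm_iterate_Sop_le_SleNorm (r : ℕ) (f : (Fin 3 → ℝ) → ℝ) {k n : ℕ} (hk : k ≤ n) :
    (eLpNorm (Sop^[k] f) (2 * r) volume).toReal ≤ SleNorm r n f :=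
  le_ciSup (f := fun α : Fin (n + 1) => (eLpNorm (Sop^[(α : ℕ)] f) (2 * r) volume).toReal)
    (Set.finite_range _).bddAbove ⟨k, Nat.lt_succ_of_le hk⟩

lemma SleNorm_nonneg (r n : ℕ) (f : (Fin 3 → ℝ) → ℝ) : 0 ≤ SleNorm r n f :=
  Real.iSup_nonneg fun _ => ENNReal.toReal_nonneg

lemma SleNorm_mono (r : ℕ) (f : (Fin 3 → ℝ) → ℝ) {m n : ℕ} (h : m ≤ n) :
    SleNorm r m f ≤ SleNorm r n f :=
  ciSup_le fun α => eLpNorm_iterate_Sop_le_SleNorm r f (by omega)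

/-- Discrete log-convexity `‖S^{≤n+1}f‖² ≤ 2(r+1)‖S^{≤n}f‖·‖S^{≤n+2}f‖` in `L^{2r}`. -/
theorem stmt16 (r n : ℕ) (hr : 1 ≤ r) (f : (Fin 3 → ℝ) → ℝ)
    (hf : ContDiff ℝ (⊤ : ℕ∞) f) (hsupp : HasCompactSupport f) :
    SleNorm r (n + 1) f ^ 2 ≤ 2 * ((r : ℝ) + 1) * SleNorm r n f * SleNorm r (n + 2) f := by
  have hM := SleNorm_nonneg r n f
  have hmono := SleNorm_mono r f (show n ≤ n + 2 by omega)
  have hprod := mul_nonneg hM (hM.trans hmono)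
  obtain ⟨⟨α, hα⟩, hmax⟩ := exists_eq_ciSup_of_finite
    (f := fun α : Fin (n + 1 + 1) => (eLpNorm (Sop^[(α : ℕ)] f) (2 * r) volume).toReal)
  change _ = SleNorm r (n + 1) f at hmax
  rw [← hmax]
  dsimp only
  rcases Nat.lt_succ_iff_lt_or_eq.1 hα with hlt | rfl
  · have hle := eLpNorm_iterate_Sop_le_SleNorm r f (Nat.le_of_lt_succ hlt)
    calc _ ≤ SleNorm r n f ^ 2 := by gcongr
      _ ≤ SleNorm r n f * SleNorm r (n + 2) f := by rw [sq]; gcongr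
      _ ≤ _ := by nlinarith [mul_nonneg (r.cast_nonneg (α := ℝ)) hprod]
  · obtain ⟨m, rfl⟩ := Nat.exists_eq_add_of_le' hr
    obtain ⟨hg, hc⟩ := contDiff_and_hasCompactSupport_iterate_Sop hf hsupp n
    have key := sq_eLpNorm_Sop_le hg hc (even_two_mul m)
    have hexp : ((2 * m + 2 : ℕ) : ENNReal) = 2 * ((m + 1 : ℕ) : ENNReal) := by
      push_cast
      ring
    simp only [← Function.iterate_succ_apply' Sop, hexp] at key
    have h₀ := eLpNorm_iterate_Sop_le_SleNorm (m + 1) f le_rfl (k := n)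
    have h₁ := eLpNorm_iterate_Sop_le_SleNorm (m + 1) f (show n + 1 ≤ n + 2 by omega)
    have h₂ := eLpNorm_iterate_Sop_le_SleNorm (m + 1) f le_rfl (k := n + 2)
    have p₁ := mul_le_mul h₀ h₁ ENNReal.toReal_nonneg hM
    have p₂ := mul_le_mul h₀ h₂ ENNReal.toReal_nonneg hM
    calc _ ≤ _ := key
      _ ≤ 3 * (SleNorm (m + 1) n f * SleNorm (m + 1) (n + 2) f) +
          (((2 * m : ℕ) : ℝ) + 1) * (SleNorm (m + 1) n f * SleNorm (m + 1) (n + 2) f) :=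
        add_le_add (mul_le_mul_of_nonneg_left p₁ (by norm_num))
          (mul_le_mul_of_nonneg_left p₂ (by positivity))
      _ = _ := by
        push_cast
        ring
end
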